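/- Losing bidders cannot profit by jointly lowering their bids (Theorem 4(i)): let L ⊆ Z be the participants, each with true cost function c̄_j that is strictly increasing, satisfies condition (i), and has c̄_j(0) = 0. Let C ⊆ L be a set of participants who all lose under truthful bidding: J*_{c̄}(L∖{j}) = J*_{c̄}(L) for every j ∈ C (with L∖{j} nonempty). Suppose each j ∈ C submits a lowered bid c̃_j with c̃_j(k) ≤ c̄_j(k) for all k, where c̃_j is also strictly increasing, satisfies condition (i) and c̃_j(0) = 0, while all other participants bid truthfully; let B̃ denote the resulting bid profile and p̃ an optimal allocation for L under B̃. Then every colluder's true utility is nonpositive: (J*_{B̃}(L∖{j}) − J*_{B̃}(L) + c̃_j(p̃_j)) − c̄_j(p̃_j) ≤ 0 for every j ∈ C. -/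

import Mathlib

/-!
STATEMENT 13: Losing bidders cannot profit by jointly lowering their bids
(Theorem 4(i) of Sessa, Walton, Kamgarpour), in the concrete clearing model (4).

`Z` is a finite set of potential participants, `L ⊆ Z` the participants; the
auctioneer must procure `M` units of power.  A bid is a cost function
`b : ℕ → ℝ` with `b 0 = 0`.  For a bid profile `B` and nonempty `S ⊆ L`, an
allocation is `p : α → ℕ` supported on `S` with `∑_{j ∈ S} p j ≥ M`, and
`J*_B(S)` is the minimal total bid cost `∑_{j ∈ S} B j (p j)` over allocations.

Each participant `j ∈ L` has a true cost function `cbar j` that is strictly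
increasing, satisfies condition (i), and has `cbar j 0 = 0`.  Let `C ⊆ L` be a
set of participants all of whom lose under truthful bidding:
`J*_{c̄}(L \ {j}) = J*_{c̄}(L)` for every `j ∈ C`.  Suppose each `j ∈ C` submits
a lowered bid `ctilde j ≤ cbar j` (also strictly increasing, satisfying
condition (i), and vanishing at `0`), while all other participants bid
truthfully; `Btilde` is the resulting bid profile, and `ptilde` an optimal
allocation for `L` under `Btilde`.  Then every colluder's true utility is
nonpositive:
`(J*_{B̃}(L \ {j}) - J*_{B̃}(L) + ctilde j (ptilde j)) - cbar j (ptilde j) ≤ 0`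
for every `j ∈ C`.
-/

/-- `p` is a feasible allocation for participants `S` with procurement target `M`. -/
def IsAlloc {α : Type*} [DecidableEq α] (S : Finset α) (M : ℕ) (p : α → ℕ) : Prop :=
  (∀ j ∉ S, p j = 0) ∧ M ≤ ∑ j ∈ S, p j

/-- The cost of allocation `p` for participants `S` under bid profile `b`. -/
def allocCost {α : Type*} (b : α → ℕ → ℝ) (S : Finset α) (p : α → ℕ) : ℝ :=
  ∑ j ∈ S, b j (p j)

/-- Condition (i): strictly increasing marginal cost. -/
def StrictlyIncreasingMarginalCost (b : ℕ → ℝ) : Prop :=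
  ∀ k : ℕ, b (k + 1) - b k < b (k + 2) - b (k + 1)

theorem aux_marg {b : ℕ → ℝ} (h : StrictlyIncreasingMarginalCost b) :
    StrictMono (fun k => b (k + 1) - b k) :=
  strictMono_nat_of_lt_succ h

theorem aux_transfer {α : Type*} [DecidableEq α] {L : Finset α} {M : ℕ} {c : α → ℕ → ℝ}
    {p : α → ℕ} (hp : IsAlloc L M p)
    (hopt : ∀ q : α → ℕ, IsAlloc L M q → allocCost c L p ≤ allocCost c L q)
    {a b : α} (ha : a ∈ L) (hb : b ∈ L) (hab : a ≠ b) {t : ℕ} (ht : p a = t + 1) :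
    c a (t + 1) - c a t ≤ c b (p b + 1) - c b (p b) := by
  have hb' : b ∈ L.erase a := Finset.mem_erase.2 ⟨hab.symm, hb⟩
  set q : α → ℕ := Function.update (Function.update p a t) b (p b + 1) with hq
  have qa : q a = t := by simp [hq, hab]
  have qb : q b = p b + 1 := by simp [hq]
  have qo : ∀ i, i ≠ a → i ≠ b → q i = p i := by
    intro i h1 h2
    simp [hq, h1, h2]
  have e1 : ∑ i ∈ (L.erase a).erase b, q i = ∑ i ∈ (L.erase a).erase b, p i := by
    refine Finset.sum_congr rfl fun i hi => ?_
    simp only [Finset.mem_erase] at hi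
    exact qo i hi.2.1 hi.1
  have e2 : ∑ i ∈ (L.erase a).erase b, c i (q i) = ∑ i ∈ (L.erase a).erase b, c i (p i) := by
    refine Finset.sum_congr rfl fun i hi => ?_
    simp only [Finset.mem_erase] at hi
    rw [qo i hi.2.1 hi.1]
  have hqa : IsAlloc L M q := by
    refine ⟨fun i hi => ?_, ?_⟩
    · rw [qo i (by rintro rfl; exact hi ha) (by rintro rfl; exact hi hb)]
      exact hp.1 i hi
    · have := hp.2
      rw [← Finset.add_sum_erase L _ ha, ← Finset.add_sum_erase _ _ hb'] at this ⊢
      rw [e1]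
      omega
  have := hopt q hqa
  unfold allocCost at this
  rw [← Finset.add_sum_erase L _ ha, ← Finset.add_sum_erase _ _ hb',
    ← Finset.add_sum_erase L (fun i => c i (q i)) ha,
    ← Finset.add_sum_erase _ (fun i => c i (q i)) hb', e2, qa, qb, ht] at this
  linarith

theorem aux_fill {α : Type*} [DecidableEq α] {D : Finset α} {M : ℕ} {B : α → ℕ → ℝ}
    {q : α → ℕ} (hq : M ≤ ∑ i ∈ D, q i) {l : ℝ} (hl : 0 ≤ l)
    (hm : ∀ i ∈ D, ∀ t < q i, B i (t + 1) - B i t ≤ l) (n : ℕ) :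
    ∀ p : α → ℕ, (∀ i ∉ D, p i = 0) → M ≤ ∑ i ∈ D, p i + n →
      ∃ p', IsAlloc D M p' ∧ allocCost B D p' ≤ allocCost B D p + n * l := by
  induction n with
  | zero => intro p h0 h; exact ⟨p, ⟨h0, by simpa using h⟩, by simp⟩
  | succ n ih =>
    intro p h0 h
    by_cases hM : M ≤ ∑ i ∈ D, p i
    · exact ⟨p, ⟨h0, hM⟩, by have : 0 ≤ ((n + 1 : ℕ) : ℝ) * l := by positivity
                             linarith⟩
    · obtain ⟨a, ha, hlt⟩ : ∃ i ∈ D, p i < q i := by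
        by_contra! hc
        exact hM (hq.trans (Finset.sum_le_sum hc))
      set r : α → ℕ := Function.update p a (p a + 1) with hr
      have ra : r a = p a + 1 := by simp [hr]
      have ro : ∀ i, i ≠ a → r i = p i := by
        intro i h1
        simp [hr, h1]
      have e1 : ∑ i ∈ D.erase a, r i = ∑ i ∈ D.erase a, p i :=
        Finset.sum_congr rfl fun i hi => ro i (Finset.ne_of_mem_erase hi)
      have e2 : ∑ i ∈ D.erase a, B i (r i) = ∑ i ∈ D.erase a, B i (p i) :=
        Finset.sum_congr rfl fun i hi => by rw [ro i (Finset.ne_of_mem_erase hi)]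
      obtain ⟨p', hp', hc⟩ := ih r
        (fun i hi => by rw [ro i (by rintro rfl; exact hi ha)]; exact h0 i hi)
        (by
          rw [← Finset.add_sum_erase D _ ha] at h ⊢
          rw [e1, ra]
          omega)
      refine ⟨p', hp', hc.trans ?_⟩
      unfold allocCost
      rw [← Finset.add_sum_erase D _ ha, ← Finset.add_sum_erase D (fun i => B i (p i)) ha, e2, ra]
      have := hm a ha _ hlt
      push_cast
      linarith

theorem losing_bidders_cannot_profit_by_jointly_lowering_bids
    {α : Type*} [DecidableEq α] (Z : Finset α) (M : ℕ)
    (L : Finset α) (hLZ : L ⊆ Z)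
    (cbar : α → ℕ → ℝ)                  -- true cost functions
    (hcbar0 : ∀ j, cbar j 0 = 0)
    (hcbarinc : ∀ j, StrictMono (cbar j))
    (hcbarmarg : ∀ j, StrictlyIncreasingMarginalCost (cbar j))
    (C : Finset α) (hCL : C ⊆ L)
    (ctilde : α → ℕ → ℝ)                -- the colluders' lowered bids
    (hctilde0 : ∀ j ∈ C, ctilde j 0 = 0)
    (hctildeinc : ∀ j ∈ C, StrictMono (ctilde j))
    (hctildemarg : ∀ j ∈ C, StrictlyIncreasingMarginalCost (ctilde j))
    (hlower : ∀ j ∈ C, ∀ k : ℕ, ctilde j k ≤ cbar j k)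
    (Btilde : α → ℕ → ℝ)                -- the resulting bid profile
    (hBtilde : Btilde = fun j => if j ∈ C then ctilde j else cbar j)
    (Jbar Jt : Finset α → ℝ)            -- optimal costs under truthful / collusive bids
    (hJbar : ∀ S : Finset α, S ⊆ L → S.Nonempty →
      IsLeast {r : ℝ | ∃ p : α → ℕ, IsAlloc S M p ∧ r = allocCost cbar S p} (Jbar S))
    (hJt : ∀ S : Finset α, S ⊆ L → S.Nonempty →
      IsLeast {r : ℝ | ∃ p : α → ℕ, IsAlloc S M p ∧ r = allocCost Btilde S p} (Jt S))
    (hLj : ∀ j ∈ C, (L.erase j).Nonempty)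
    (hlosers : ∀ j ∈ C, Jbar (L.erase j) = Jbar L)  -- all colluders lose when truthful
    (ptilde : α → ℕ)
    (hpt : IsAlloc L M ptilde)
    (hptopt : ∀ q : α → ℕ, IsAlloc L M q →
      allocCost Btilde L ptilde ≤ allocCost Btilde L q) :
    ∀ j ∈ C,
      (Jt (L.erase j) - Jt L + ctilde j (ptilde j)) - cbar j (ptilde j) ≤ 0 := by
  intro j hj
  have hjL := hCL hj
  have lose : ∀ i ∈ C, ∃ q : α → ℕ, IsAlloc (L.erase i) M q ∧ q i = 0 ∧ IsAlloc L M q ∧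
      ∀ r : α → ℕ, IsAlloc L M r → allocCost cbar L q ≤ allocCost cbar L r := by
    intro i hi
    have hiL := hCL hi
    obtain ⟨q, hq, hqc⟩ := (hJbar (L.erase i) (Finset.erase_subset _ _) (hLj i hi)).1
    have q0 : q i = 0 := hq.1 i (by simp)
    refine ⟨q, hq, q0, ⟨fun k hk => hq.1 k fun h => hk (Finset.mem_of_mem_erase h), ?_⟩, ?_⟩
    · rw [← Finset.add_sum_erase L _ hiL, q0, zero_add]
      exact hq.2
    · intro r hr
      have h1 : allocCost cbar L q = Jbar L := by
        rw [← hlosers i hi, hqc]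
        unfold allocCost
        rw [← Finset.add_sum_erase L _ hiL, q0, hcbar0, zero_add]
      rw [h1]
      exact (hJbar L subset_rfl ⟨i, hiL⟩).2 ⟨r, hr, rfl⟩
  obtain ⟨q, hqD, qj, hqL, hqopt⟩ := lose j hj
  have small : ∀ i ∈ C, q i ≤ 1 := by
    intro i hi
    by_contra! hlt
    have hiL := hCL hi
    obtain ⟨r, -, ri, hrL, hropt⟩ := lose i hi
    obtain ⟨k, hk, hkr⟩ : ∃ k ∈ L, q k < r k := by
      by_contra! hc
      have h1 : allocCost cbar L r < allocCost cbar L q := by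
        refine Finset.sum_lt_sum (fun k hk => (hcbarinc k).monotone (hc k hk)) ⟨i, hiL, ?_⟩
        exact hcbarinc i (by omega)
      exact absurd (hqopt r hrL) (not_le.2 h1)
    have hki : k ≠ i := by
      rintro rfl
      omega
    obtain ⟨t, ht⟩ : ∃ t, r k = t + 1 := ⟨r k - 1, by omega⟩
    obtain ⟨s, hs⟩ : ∃ s, q i = s + 1 := ⟨q i - 1, by omega⟩
    have h1 := aux_transfer hrL hropt hk hiL hki ht
    have h2 := aux_transfer hqL hqopt hiL hk hki.symm hs
    have h3 := (aux_marg (hcbarmarg k)).monotone (show q k ≤ t by omega)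
    have h4 := (aux_marg (hcbarmarg i)) (show 0 < s by omega)
    simp only at h3 h4
    rw [ri] at h1
    linarith
  have hl : 0 ≤ cbar j 1 := by
    have := (hcbarinc j) Nat.zero_lt_one
    rw [hcbar0] at this
    exact this.le
  have hm : ∀ i ∈ L.erase j, ∀ t < q i, Btilde i (t + 1) - Btilde i t ≤ cbar j 1 := by
    intro i hi t ht
    obtain ⟨hij, hiL⟩ := Finset.mem_erase.1 hi
    obtain ⟨s, hs⟩ : ∃ s, q i = s + 1 := ⟨q i - 1, by omega⟩
    have h2 := aux_transfer hqL hqopt hiL hjL hij hs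
    rw [qj, hcbar0, zero_add, sub_zero] at h2
    have h3 := (aux_marg (hcbarmarg i)).monotone (show t ≤ s by omega)
    beta_reduce at h3
    by_cases hiC : i ∈ C
    · have := small i hiC
      obtain rfl : t = 0 := by omega
      have h4 := hlower i hiC 1
      simp only [hBtilde, hiC, if_true, hctilde0 i hiC]
      rw [hcbar0] at h3
      simp only [zero_add] at h3 ⊢
      linarith
    · simp only [hBtilde, hiC, if_false]
      linarith
  have hx : ∀ x : ℕ, (x : ℝ) * cbar j 1 ≤ cbar j x := by
    intro x
    induction x with
    | zero => simp [hcbar0]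
    | succ x ih =>
      have h3 := (aux_marg (hcbarmarg j)).monotone (Nat.zero_le x)
      simp only [zero_add, hcbar0] at h3
      push_cast
      linarith
  set p : α → ℕ := Function.update ptilde j 0 with hp
  have po : ∀ i ∈ L.erase j, p i = ptilde i := by
    intro i hi
    simp [hp, Finset.ne_of_mem_erase hi]
  have s1 : ∑ i ∈ L.erase j, p i = ∑ i ∈ L.erase j, ptilde i := Finset.sum_congr rfl po
  have s2 : allocCost Btilde (L.erase j) p = allocCost Btilde (L.erase j) ptilde :=
    Finset.sum_congr rfl fun i hi => by rw [po i hi]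
  obtain ⟨p', hp', hc⟩ := aux_fill hqD.2 hl hm (ptilde j) p
    (by
      intro i hi
      by_cases hij : i = j
      · simp [hp, hij]
      · simp only [hp, Function.update_of_ne hij]
        exact hpt.1 i fun h => hi (Finset.mem_erase.2 ⟨hij, h⟩))
    (by
      have := hpt.2
      rw [← Finset.add_sum_erase L _ hjL] at this
      rw [s1]
      omega)
  have h1 : Jt (L.erase j) ≤ allocCost Btilde (L.erase j) p' :=
    (hJt (L.erase j) (Finset.erase_subset _ _) (hLj j hj)).2 ⟨p', hp', rfl⟩
  have h2 : allocCost Btilde L ptilde ≤ Jt L := by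
    obtain ⟨r, hr, hrc⟩ := (hJt L subset_rfl ⟨j, hjL⟩).1
    rw [hrc]
    exact hptopt r hr
  have h3 : allocCost Btilde L ptilde
      = ctilde j (ptilde j) + allocCost Btilde (L.erase j) ptilde := by
    unfold allocCost
    rw [← Finset.add_sum_erase L _ hjL]
    congr 1
    simp [hBtilde, hj]
  have := hx (ptilde j)
  linarith
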